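/- arXiv:1912.08546 — 11 statements merged into one kernel-verified Lean document; each statement's English description precedes it below -/
import Mathlib

section
/- Let f : ℝ^n → ℝ be convex and differentiable, and suppose its gradient is Lipschitz continuous with constant C > 0, i.e., ‖∇f(x) − ∇f(y)‖ ≤ C‖x − y‖ for all x, y ∈ ℝ^n. Then the gradient is co-coercive: for all x, y ∈ ℝ^n, (x − y)ᵀ(∇f(x) − ∇f(y)) ≥ ‖∇f(x) − ∇f(y)‖² / C. -/
open scoped RealInnerProductSpace

section GradientInequalities

variable {E : Type*} [NormedAddCommGroup E] [InnerProductSpace ℝ E] [CompleteSpace E]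
  {f : E → ℝ}

/-- The derivative of a differentiable function along a line. -/
theorem Differentiable.hasDerivAt_comp_line (hdiff : Differentiable ℝ f) (x v : E) (t : ℝ) :
    HasDerivAt (fun s : ℝ => f (x + s • v)) ⟪gradient f (x + t • v), v⟫ t := by
  have hline : HasDerivAt (fun s : ℝ => x + s • v) v t := by
    simpa using ((hasDerivAt_id t).smul_const v).const_add x
  rw [inner_gradient_left]
  exact (hdiff (x + t • v)).hasFDerivAt.comp_hasDerivAt t hline

/-- A differentiable convex function lies above its tangent hyperplanes. -/
theorem ConvexOn.add_inner_gradient_le (hconv : ConvexOn ℝ Set.univ f)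
    (hdiff : Differentiable ℝ f) (x v : E) : f x + ⟪gradient f x, v⟫ ≤ f (x + v) := by
  have hline : ConvexOn ℝ Set.univ (fun s : ℝ => f (x + s • v)) := by
    refine ⟨convex_univ, fun s _ t _ a b ha hb hab => ?_⟩
    have h := hconv.2 (Set.mem_univ (x + s • v)) (Set.mem_univ (x + t • v)) ha hb hab
    have hcomb : x + (a • s + b • t) • v = a • (x + s • v) + b • (x + t • v) := by
      nth_rewrite 1 [← one_smul ℝ x, ← hab]
      simp only [smul_eq_mul]
      module
    simpa only [hcomb] using h
  have h := hline.le_slope_of_hasDerivAt (Set.mem_univ 0) (Set.mem_univ 1) one_pos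
    (hdiff.hasDerivAt_comp_line x v 0)
  simp [slope_def_field, -inner_gradient_left] at h
  linarith

/-- The quadratic upper bound for a function with Lipschitz gradient. -/
theorem Differentiable.le_add_inner_gradient_add_sq {C : ℝ} (hdiff : Differentiable ℝ f)
    (hlip : ∀ x y, ‖gradient f x - gradient f y‖ ≤ C * ‖x - y‖) (x v : E) :
    f (x + v) ≤ f x + ⟪gradient f x, v⟫ + C / 2 * ‖v‖ ^ 2 := by
  have hderiv (t : ℝ) : HasDerivAt
      (fun s : ℝ => f (x + s • v) - s * ⟪gradient f x, v⟫ - s ^ 2 * (C / 2 * ‖v‖ ^ 2))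
      (⟪gradient f (x + t • v) - gradient f x, v⟫ - t * (C * ‖v‖ ^ 2)) t := by
    refine (((hdiff.hasDerivAt_comp_line x v t).sub
      ((hasDerivAt_id t).mul_const ⟪gradient f x, v⟫)).sub
      ((hasDerivAt_pow 2 t).mul_const (C / 2 * ‖v‖ ^ 2))).congr_deriv ?_
    rw [inner_sub_left]
    push_cast
    ring
  have hanti := antitoneOn_of_deriv_nonpos (convex_Ici (0 : ℝ))
    (fun t _ => (hderiv t).continuousAt.continuousWithinAt)
    (fun t _ => (hderiv t).differentiableAt.differentiableWithinAt)
    (fun t ht => by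
      rw [interior_Ici, Set.mem_Ioi] at ht
      rw [(hderiv t).deriv, sub_nonpos]
      calc ⟪gradient f (x + t • v) - gradient f x, v⟫
          ≤ ‖gradient f (x + t • v) - gradient f x‖ * ‖v‖ := real_inner_le_norm _ _
        _ ≤ C * ‖x + t • v - x‖ * ‖v‖ := by gcongr; exact hlip _ _
        _ = t * (C * ‖v‖ ^ 2) := by
          rw [add_sub_cancel_left, norm_smul, Real.norm_of_nonneg ht.le]
          ring)
  have h := hanti (Set.mem_Ici.2 le_rfl) (Set.mem_Ici.2 zero_le_one) zero_le_one
  simp [-inner_gradient_left] at h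
  linarith

/-- The tangent inequality for a convex function with Lipschitz gradient, improved by a
quadratic term in the difference of the gradients. -/
theorem ConvexOn.add_inner_gradient_add_sq_le {C : ℝ} (hC : 0 < C)
    (hconv : ConvexOn ℝ Set.univ f) (hdiff : Differentiable ℝ f)
    (hlip : ∀ x y, ‖gradient f x - gradient f y‖ ≤ C * ‖x - y‖) (x y : E) :
    f x + ⟪gradient f x, y - x⟫ + ‖gradient f y - gradient f x‖ ^ 2 / (2 * C) ≤ f y := by
  set d := gradient f y - gradient f x with hd
  have hupper := hdiff.le_add_inner_gradient_add_sq hlip y (-(C⁻¹ • d))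
  have hlower := hconv.add_inner_gradient_le hdiff x (y - x + -(C⁻¹ • d))
  rw [show x + (y - x + -(C⁻¹ • d)) = y + -(C⁻¹ • d) by abel, inner_add_right] at hlower
  simp only [inner_neg_right, inner_smul_right, norm_neg, norm_smul, mul_pow,
    Real.norm_of_nonneg (inv_nonneg.2 hC.le)] at hupper hlower
  have hinner : C⁻¹ * ⟪gradient f y, d⟫ - C⁻¹ * ⟪gradient f x, d⟫ = C⁻¹ * ‖d‖ ^ 2 := by
    rw [← mul_sub, ← inner_sub_left, ← hd, real_inner_self_eq_norm_sq]
  have hquad : C / 2 * (C⁻¹ ^ 2 * ‖d‖ ^ 2) = C⁻¹ * ‖d‖ ^ 2 - ‖d‖ ^ 2 / (2 * C) := by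
    field_simp
    ring
  linarith

end GradientInequalities

/-- Co-coercivity of the gradient of a convex function with `C`-Lipschitz gradient. -/
theorem cocoercivity_of_lipschitz_gradient
    (n : ℕ) (f : EuclideanSpace ℝ (Fin n) → ℝ) (C : ℝ) (hC : 0 < C)
    (hconv : ConvexOn ℝ Set.univ f)
    (hdiff : Differentiable ℝ f)
    (hlip : ∀ x y : EuclideanSpace ℝ (Fin n),
      ‖gradient f x - gradient f y‖ ≤ C * ‖x - y‖) :
    ∀ x y : EuclideanSpace ℝ (Fin n),
      ⟪x - y, gradient f x - gradient f y⟫ ≥ ‖gradient f x - gradient f y‖ ^ 2 / C := by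
  intro x y
  have hxy := hconv.add_inner_gradient_add_sq_le hC hdiff hlip x y
  have hyx := hconv.add_inner_gradient_add_sq_le hC hdiff hlip y x
  rw [norm_sub_rev, ← neg_sub x y, inner_neg_right] at hxy
  have hhalves : ‖gradient f x - gradient f y‖ ^ 2 / C =
      ‖gradient f x - gradient f y‖ ^ 2 / (2 * C) +
        ‖gradient f x - gradient f y‖ ^ 2 / (2 * C) := by
    field_simp
    ring
  rw [real_inner_comm, inner_sub_left, hhalves]
  linarith
end

section
/- Let f : ℝ^N → ℝ be differentiable, let L be a symmetric N×N real matrix, and let x⋆, η⋆ ∈ ℝ^N satisfy L x⋆ = 0 and ∇f(x⋆) = −L η⋆. Suppose (x, η) : ℝ → ℝ^N × ℝ^N is differentiable and satisfies the continuous-time primal-dual dynamics ẋ(t) = −∇f(x(t)) − L η(t) − L x(t) and η̇(t) = L x(t) for all t ∈ ℝ. Define V(x, η) = (1/2)‖x − x⋆‖² + (1/2)‖η − η⋆‖². Then for every t ∈ ℝ, d/dt V(x(t), η(t)) = −(x(t) − x⋆)ᵀ(∇f(x(t)) − ∇f(x⋆)) − (x(t) − x⋆)ᵀ L (x(t) −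 x⋆). -/
open scoped RealInnerProductSpace

/-- Derivative of the Lyapunov candidate `V(x,η) = ½‖x-x⋆‖² + ½‖η-η⋆‖²` along trajectories
of the continuous-time primal-dual dynamics. -/
theorem lyapunov_deriv_along_primal_dual
    (N : ℕ) (f : EuclideanSpace ℝ (Fin N) → ℝ)
    (hdiff : Differentiable ℝ f)
    (L : Matrix (Fin N) (Fin N) ℝ) (hL : L.IsSymm)
    (xs ηs : EuclideanSpace ℝ (Fin N))
    (hxs : Matrix.toEuclideanLin L xs = 0)
    (hgrad : gradient f xs = -(Matrix.toEuclideanLin L ηs))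
    (x η : ℝ → EuclideanSpace ℝ (Fin N))
    (hx : ∀ t : ℝ, HasDerivAt x
      (-(gradient f (x t)) - Matrix.toEuclideanLin L (η t) - Matrix.toEuclideanLin L (x t)) t)
    (hη : ∀ t : ℝ, HasDerivAt η (Matrix.toEuclideanLin L (x t)) t) :
    ∀ t : ℝ, HasDerivAt
      (fun s : ℝ => (1/2) * ‖x s - xs‖ ^ 2 + (1/2) * ‖η s - ηs‖ ^ 2)
      (-⟪x t - xs, gradient f (x t) - gradient f xs⟫
        - ⟪x t - xs, Matrix.toEuclideanLin L (x t - xs)⟫) t := by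
  intro t
  have hT : (Matrix.toEuclideanLin L).IsSymmetric := by
    rw [Matrix.isSymmetric_toEuclideanLin_iff, Matrix.IsHermitian,
      Matrix.conjTranspose_eq_transpose_of_trivial]
    exact hL
  have hV := ((((hx t).sub_const xs).norm_sq).const_mul (1 / 2)).add
    ((((hη t).sub_const ηs).norm_sq).const_mul (1 / 2))
  refine hV.congr_deriv ?_
  have h₁ := hT (x t) (η t)
  have h₂ := hT (x t) ηs
  have h₃ := hT xs (η t)
  have h₄ := hT xs ηs
  rw [hxs, inner_zero_left] at h₃ h₄
  rw [real_inner_comm] at h₁ h₂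
  simp only [hgrad, map_sub, hxs, inner_sub_left, inner_sub_right, inner_neg_right, inner_zero_right]
  linarith
end

section
/- Let f : ℝ^N → ℝ be convex and differentiable, let L be a symmetric positive semidefinite N×N real matrix, and let x⋆, η⋆ ∈ ℝ^N satisfy L x⋆ = 0 and ∇f(x⋆) = −L η⋆. Suppose (x, η) : ℝ → ℝ^N × ℝ^N is differentiable and satisfies ẋ(t) = −∇f(x(t)) − L η(t) − L x(t) and η̇(t) = L x(t) for all t ∈ ℝ. Then the function t ↦ V(x(t), η(t)), where V(x, η) = (1/2)‖x − x⋆‖² + (1/2)‖η − η⋆‖², is nonincreasing on ℝ. -/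
open scoped RealInnerProductSpace

/-- First-order condition: a convex function lies above its tangent hyperplanes. -/
theorem ConvexOn.inner_gradient_le_sub {E : Type*} [NormedAddCommGroup E]
    [InnerProductSpace ℝ E] [CompleteSpace E] {f : E → ℝ}
    (hconv : ConvexOn ℝ Set.univ f) {a : E} (ha : DifferentiableAt ℝ f a) (b : E) :
    ⟪gradient f a, b - a⟫ ≤ f b - f a := by
  have hline : ConvexOn ℝ Set.univ (f ∘ AffineMap.lineMap (k := ℝ) a b) := by
    simpa using hconv.comp_affineMap (AffineMap.lineMap (k := ℝ) a b)
  have hderiv : HasDerivAt (f ∘ AffineMap.lineMap (k := ℝ) a b) ⟪gradient f a, b - a⟫ 0 := by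
    have hf : HasFDerivAt f (InnerProductSpace.toDual ℝ E (gradient f a))
        (AffineMap.lineMap (k := ℝ) a b 0) := by
      simpa using ha.hasGradientAt.hasFDerivAt
    simpa using hf.comp_hasDerivAt (0 : ℝ) AffineMap.hasDerivAt_lineMap
  simpa [slope_def_field] using
    hline.le_slope_of_hasDerivAt (Set.mem_univ 0) (Set.mem_univ 1) one_pos hderiv

/-- The gradient of a convex differentiable function is a monotone operator. -/
theorem ConvexOn.inner_gradient_sub_nonneg {E : Type*} [NormedAddCommGroup E]
    [InnerProductSpace ℝ E] [CompleteSpace E] {f : E → ℝ}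
    (hconv : ConvexOn ℝ Set.univ f) {a b : E} (ha : DifferentiableAt ℝ f a)
    (hb : DifferentiableAt ℝ f b) :
    0 ≤ ⟪gradient f a - gradient f b, a - b⟫ := by
  have h₁ := hconv.inner_gradient_le_sub ha b
  have h₂ := hconv.inner_gradient_le_sub hb a
  rw [← neg_sub a b, inner_neg_right] at h₁
  rw [inner_sub_left]
  linarith

/-- The Lyapunov candidate `V(x,η) = ½‖x-x⋆‖² + ½‖η-η⋆‖²` is nonincreasing along
trajectories of the continuous-time primal-dual dynamics when `f` is convex and `L` is
symmetric positive semidefinite. -/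
theorem lyapunov_antitone_along_primal_dual
    (N : ℕ) (f : EuclideanSpace ℝ (Fin N) → ℝ)
    (hconv : ConvexOn ℝ Set.univ f)
    (hdiff : Differentiable ℝ f)
    (L : Matrix (Fin N) (Fin N) ℝ) (hL : L.PosSemidef)
    (xs ηs : EuclideanSpace ℝ (Fin N))
    (hxs : Matrix.toEuclideanLin L xs = 0)
    (hgrad : gradient f xs = -(Matrix.toEuclideanLin L ηs))
    (x η : ℝ → EuclideanSpace ℝ (Fin N))
    (hx : ∀ t : ℝ, HasDerivAt x
      (-(gradient f (x t)) - Matrix.toEuclideanLin L (η t) - Matrix.toEuclideanLin L (x t)) t)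
    (hη : ∀ t : ℝ, HasDerivAt η (Matrix.toEuclideanLin L (x t)) t) :
    Antitone (fun s : ℝ => (1/2) * ‖x s - xs‖ ^ 2 + (1/2) * ‖η s - ηs‖ ^ 2) := by
  have hpos := Matrix.isPositive_toEuclideanLin_iff.mpr hL
  have hV (t : ℝ) := (((hx t).sub_const xs).norm_sq.const_mul (1 / 2)).add
    (((hη t).sub_const ηs).norm_sq.const_mul (1 / 2))
  refine antitone_of_hasDerivAt_nonpos hV fun t => ?_
  have hmono := hconv.inner_gradient_sub_nonneg (hdiff (x t)) (hdiff xs)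
  have hdiss := hpos.re_inner_nonneg_right (x t)
  have hsymm (v : EuclideanSpace ℝ (Fin N)) :
      ⟪x t - xs, Matrix.toEuclideanLin L v⟫ = ⟪v, Matrix.toEuclideanLin L (x t)⟫ := by
    rw [← hpos.isSymmetric, map_sub, hxs, sub_zero, real_inner_comm]
  rw [hgrad, sub_neg_eq_add, real_inner_comm, inner_add_right, hsymm] at hmono
  simp only [RCLike.re_to_real] at hdiss
  simp only [Pi.zero_apply, inner_sub_right, inner_neg_right, hsymm, inner_sub_left (η t) ηs]
  linarith
end

section
/- Let f : ℝ^N → ℝ be differentiable, let L be a symmetric N×N real matrix, and let x⋆ ∈ ℝ^N satisfy L x⋆ = 0 and ∇f(x⋆) = −L η⋆ for some η⋆ ∈ ℝ^N. Suppose (x, η) : ℝ → ℝ^N × ℝ^N is differentiable, satisfies ẋ(t) = −∇f(x(t)) − L η(t) − L x(t) and η̇(t) = L x(t) for all t ∈ ℝ, and moreover ∇f(x(t)) = ∇f(x⋆) and L x(t) = 0 for all t ∈ ℝ. Then η is constant, i.e., η(t) = η(0) for all t, and ∇f(x⋆) = −L η(0); consequently every point (x(t), η(0)) on the trajectory satisfies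 the KKT conditions ∇f(x(t)) = −L η(0) and L x(t) = 0 for the problem of minimizing f subject to L x = 0. -/
open scoped RealInnerProductSpace

/-- The range of a symmetric operator meets its kernel only in zero. -/
lemma LinearMap.IsSymmetric.apply_eq_zero_of_apply_apply_eq_zero
    {E : Type*} [NormedAddCommGroup E] [InnerProductSpace ℝ E] {T : E →ₗ[ℝ] E}
    (hT : T.IsSymmetric) {w : E} (hw : T (T w) = 0) : T w = 0 := by
  rw [← inner_self_eq_zero (𝕜 := ℝ), hT, hw, inner_zero_right]

/-- A linear map annihilating a curve annihilates its velocity. -/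
lemma LinearMap.apply_eq_zero_of_hasDerivAt
    {E F : Type*} [NormedAddCommGroup E] [NormedSpace ℝ E] [FiniteDimensional ℝ E]
    [NormedAddCommGroup F] [NormedSpace ℝ F] (T : E →ₗ[ℝ] F) {x : ℝ → E} {v : E} {t : ℝ}
    (hx : HasDerivAt x v t) (hT : ∀ s, T (x s) = 0) : T v = 0 := by
  have h := (LinearMap.toContinuousLinearMap T).hasFDerivAt.comp_hasDerivAt t hx
  have hzero : (LinearMap.toContinuousLinearMap T) ∘ x = fun _ => 0 := funext hT
  rw [hzero] at h
  exact h.unique (hasDerivAt_const t 0)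

/-- A trajectory of the primal-dual dynamics along which `∇f(x(t)) = ∇f(x⋆)` and
`L x(t) = 0` has constant dual variable, and every point on it is a KKT point of the
problem of minimizing `f` subject to `L x = 0`. -/
theorem invariant_trajectory_is_KKT
    (N : ℕ) (f : EuclideanSpace ℝ (Fin N) → ℝ)
    (hdiff : Differentiable ℝ f)
    (L : Matrix (Fin N) (Fin N) ℝ) (hL : L.IsSymm)
    (xs ηs : EuclideanSpace ℝ (Fin N))
    (hxs : Matrix.toEuclideanLin L xs = 0)
    (hgrad : gradient f xs = -(Matrix.toEuclideanLin L ηs))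
    (x η : ℝ → EuclideanSpace ℝ (Fin N))
    (hx : ∀ t : ℝ, HasDerivAt x
      (-(gradient f (x t)) - Matrix.toEuclideanLin L (η t) - Matrix.toEuclideanLin L (x t)) t)
    (hη : ∀ t : ℝ, HasDerivAt η (Matrix.toEuclideanLin L (x t)) t)
    (hgradx : ∀ t : ℝ, gradient f (x t) = gradient f xs)
    (hLx : ∀ t : ℝ, Matrix.toEuclideanLin L (x t) = 0) :
    (∀ t : ℝ, η t = η 0) ∧
    gradient f xs = -(Matrix.toEuclideanLin L (η 0)) ∧
    (∀ t : ℝ, gradient f (x t) = -(Matrix.toEuclideanLin L (η 0)) ∧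
      Matrix.toEuclideanLin L (x t) = 0) := by
  have hconst : ∀ t, η t = η 0 := fun t =>
    is_const_of_deriv_eq_zero (fun s => (hη s).differentiableAt)
      (fun s => (hη s).deriv.trans (hLx s)) t 0
  have hsymm : (Matrix.toEuclideanLin L).IsSymmetric :=
    Matrix.isSymmetric_toEuclideanLin_iff.mpr (by
      rw [Matrix.IsHermitian, Matrix.conjTranspose_eq_transpose_of_trivial]
      exact hL)
  have hvel : -(gradient f (x 0)) - Matrix.toEuclideanLin L (η 0) - Matrix.toEuclideanLin L (x 0)
      = Matrix.toEuclideanLin L (ηs - η 0) := by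
    rw [hgradx, hgrad, hLx, map_sub, neg_neg, sub_zero]
  have hker := (Matrix.toEuclideanLin L).apply_eq_zero_of_hasDerivAt (hx 0) hLx
  rw [hvel] at hker
  have hdual : Matrix.toEuclideanLin L ηs = Matrix.toEuclideanLin L (η 0) := by
    rw [← sub_eq_zero, ← map_sub]
    exact hsymm.apply_eq_zero_of_apply_apply_eq_zero hker
  rw [hdual] at hgrad
  exact ⟨hconst, hgrad, fun t => ⟨(hgradx t).trans hgrad, hLx t⟩⟩
end

section
/- Let φ be a continuous flow on a metric space E (i.e., φ₀ = id and φ_{t+s} = φ_t ∘ φ_s for all t, s ∈ ℝ), let x ∈ E be a point whose forward orbit {φ_t(x) : t ≥ 0} has compact closure, and let V : E → ℝ be continuous such that t ↦ V(φ_t(x)) is nonincreasing on [0, ∞). Then V is constant on the ω-limit set of x: there exists c ∈ ℝ such that V(p) = c for every p ∈ ω(x), where ω(x) = ⋂_{T ≥ 0} closure{φ_t(x) : t ≥ T}. -/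
/-- LaSalle-type statement: a continuous function `V` that is nonincreasing along a
forward-precompact trajectory of a continuous flow is constant on the ω-limit set of
the trajectory. -/
theorem lyapunov_constant_on_omega_limit
    {E : Type*} [MetricSpace E]
    (φ : ℝ → E → E)
    (hcont : Continuous fun p : ℝ × E => φ p.1 p.2)
    (h0 : ∀ y : E, φ 0 y = y)
    (hadd : ∀ t s : ℝ, ∀ y : E, φ (t + s) y = φ t (φ s y))
    (x : E)
    (hcompact : IsCompact (closure {y : E | ∃ t : ℝ, 0 ≤ t ∧ y = φ t x}))
    (V : E → ℝ) (hV : Continuous V)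
    (hmono : AntitoneOn (fun t : ℝ => V (φ t x)) (Set.Ici (0 : ℝ))) :
    ∃ c : ℝ, ∀ p ∈ ⋂ T ∈ Set.Ici (0 : ℝ), closure {y : E | ∃ t : ℝ, T ≤ t ∧ y = φ t x},
      V p = c := by
  have key : ∀ p ∈ ⋂ T ∈ Set.Ici (0 : ℝ), closure {y : E | ∃ t : ℝ, T ≤ t ∧ y = φ t x},
      ∀ q ∈ ⋂ T ∈ Set.Ici (0 : ℝ), closure {y : E | ∃ t : ℝ, T ≤ t ∧ y = φ t x},
      V p ≤ V q := by
    intro p hp q hq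
    rw [Set.mem_iInter₂] at hp hq
    have hp_le : ∀ T : ℝ, 0 ≤ T → V p ≤ V (φ T x) := by
      intro T hT
      refine closure_minimal (t := {y | V y ≤ V (φ T x)}) ?_
        (isClosed_le hV continuous_const) (hp T hT)
      rintro _ ⟨t, ht, rfl⟩
      exact hmono hT (hT.trans ht) ht
    refine closure_minimal (t := {y | V p ≤ V y}) ?_
      (isClosed_le continuous_const hV) (hq 0 Set.self_mem_Ici)
    rintro _ ⟨t, ht, rfl⟩
    exact hp_le t ht
  rcases Set.eq_empty_or_nonempty
    (⋂ T ∈ Set.Ici (0 : ℝ), closure {y : E | ∃ t : ℝ, T ≤ t ∧ y = φ t x}) with h | ⟨q, hq⟩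
  · rw [h]
    exact ⟨0, fun p hp => hp.elim⟩
  · exact ⟨V q, fun p hp => le_antisymm (key p hp q hq) (key q hq p hp)⟩
end

section
/- Let L be a symmetric positive semidefinite N×N real matrix with positive semidefinite square root L^{1/2}, let W = I − L, let ρ > 0, α = 1/ρ, and let f : ℝ^N → ℝ be differentiable. Define the augmented Lagrangian 𝓛(x, λ) = f(x) + ρ λᵀ L^{1/2} x + (ρ/2) xᵀ L x, so that ∇_x 𝓛(x, λ) = ∇f(x) + ρ L^{1/2} λ + ρ L x and ∇_λ 𝓛(x, λ) = ρ L^{1/2} x. Suppose the sequences (x^{(k)}, λ^{(k)})_{k ≥ 0} in ℝ^N × ℝ^N satisfy λ^{(0)} = 0, x^{(k+1)} = x^{(k)} − α ∇_x 𝓛(x^{(k)}, λ^{(k)}), and λ^{(k+1)} = λ^{(k)} + α ∇_λ 𝓛(x^{(k+1)}, λ^{(k)}). Then x^{(1)} = W x^{(0)} − α ∇f(x^{(0)}), and for every k ≥ 1, x^{(k+1)} = 2 W x^{(k)} − α ∇f(x^{(k)}) − W x^{(k−1)} + α ∇f(x^{(k−1)}); that is, the primal-dual iteration generates exactly the EXTRA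 iterates. -/
open scoped RealInnerProductSpace

/-- The primal-dual (Arrow–Hurwicz–Uzawa-type) iteration on the consensus augmented
Lagrangian `𝓛(x,λ) = f(x) + ρ λᵀ L^{1/2} x + (ρ/2) xᵀ L x`, with `α = 1/ρ` and zero
initial dual variable, generates exactly the EXTRA iterates with `W = I - L`. -/
theorem primal_dual_is_EXTRA
    (N : ℕ) (L Lh : Matrix (Fin N) (Fin N) ℝ)
    (hL : L.PosSemidef) (hLh : Lh.PosSemidef) (hsq : Lh * Lh = L)
    (W : Matrix (Fin N) (Fin N) ℝ) (hW : W = 1 - L)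
    (ρ α : ℝ) (hρ : 0 < ρ) (hα : α = 1 / ρ)
    (f : EuclideanSpace ℝ (Fin N) → ℝ) (hdiff : Differentiable ℝ f)
    (x lam : ℕ → EuclideanSpace ℝ (Fin N))
    (hlam0 : lam 0 = 0)
    (hx : ∀ k : ℕ, x (k + 1) = x k - α • (gradient f (x k)
      + ρ • Matrix.toEuclideanLin Lh (lam k) + ρ • Matrix.toEuclideanLin L (x k)))
    (hlam : ∀ k : ℕ, lam (k + 1) = lam k + α • (ρ • Matrix.toEuclideanLin Lh (x (k + 1)))) :
    x 1 = Matrix.toEuclideanLin W (x 0) - α • gradient f (x 0) ∧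
    ∀ k : ℕ, 1 ≤ k →
      x (k + 1) = (2 : ℝ) • Matrix.toEuclideanLin W (x k) - α • gradient f (x k)
        - Matrix.toEuclideanLin W (x (k - 1)) + α • gradient f (x (k - 1)) := by
  have hαρ : α * ρ = 1 := by rw [hα, one_div_mul_cancel hρ.ne']
  have hWv (v : EuclideanSpace ℝ (Fin N)) :
      Matrix.toEuclideanLin W v = v - Matrix.toEuclideanLin L v := by
    ext i
    simp [hW]
  have hLv (v : EuclideanSpace ℝ (Fin N)) :
      Matrix.toEuclideanLin Lh (Matrix.toEuclideanLin Lh v) = Matrix.toEuclideanLin L v := by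
    ext i
    simp [← hsq, Matrix.mulVec_mulVec]
  simp only [smul_add, smul_smul, hαρ, one_smul] at hx hlam
  constructor
  · rw [hWv, hx 0, hlam0, map_zero]
    abel
  · intro k hk
    obtain ⟨j, rfl⟩ := Nat.exists_eq_add_of_le' hk
    have hdual : Matrix.toEuclideanLin Lh (lam j) =
        x j - α • gradient f (x j) - Matrix.toEuclideanLin L (x j) - x (j + 1) := by
      rw [hx j]
      abel
    rw [hx (j + 1), hlam j, map_add, hLv, hdual, hWv, hWv, Nat.add_sub_cancel]
    module
end

section
/- Let L be a symmetric positive semidefinite N×N real matrix with positive semidefinite square root L^{1/2}, let W = I − L, let ρ > 0, α = 1/ρ, and let f : ℝ^N → ℝ be differentiable. Define the augmented Lagrangian 𝓛(x, λ) = f(x) + ρ λᵀ L^{1/2} x + (ρ/2) xᵀ L x, so that ∇_x 𝓛(x, λ) = ∇f(x) + ρ L^{1/2} λ + ρ L x and ∇_λ 𝓛(x, λ) = ρ L^{1/2} x. Suppose the sequences (x^{(k)}, λ^{(k)})_{k ≥ 0} satisfy λ^{(0)} = 0, x^{(k+1)} = x^{(k)} − α ∇_x 𝓛(x^{(k)},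 λ^{(k)}), and λ^{(k+1)} = λ^{(k)} + α ∇_λ 𝓛(x^{(k+1)}, λ^{(k)}) − α W ∇_λ 𝓛(x^{(k)}, λ^{(k)}). Define s^{(k)} = ∇f(x^{(k)}) + ρ L^{1/2} λ^{(k)}. Then s^{(0)} = ∇f(x^{(0)}), and for every k ≥ 0, x^{(k+1)} = W x^{(k)} − α s^{(k)} and s^{(k+1)} = W s^{(k)} + ∇f(x^{(k+1)}) − ∇f(x^{(k)}); that is, the primal-dual iteration generates exactly the gradient-tracking (DIGing/harnessing) iterates. -/
open scoped RealInnerProductSpace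

/-- The primal-dual iteration on the consensus augmented Lagrangian
`𝓛(x,λ) = f(x) + ρ λᵀ L^{1/2} x + (ρ/2) xᵀ L x`, with `α = 1/ρ`, zero initial dual
variable and the corrected dual ascent step, generates exactly the gradient-tracking
(DIGing/harnessing) iterates with `W = I - L`. -/
theorem primal_dual_is_gradient_tracking
    (N : ℕ) (L Lh : Matrix (Fin N) (Fin N) ℝ)
    (hL : L.PosSemidef) (hLh : Lh.PosSemidef) (hsq : Lh * Lh = L)
    (W : Matrix (Fin N) (Fin N) ℝ) (hW : W = 1 - L)
    (ρ α : ℝ) (hρ : 0 < ρ) (hα : α = 1 / ρ)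
    (f : EuclideanSpace ℝ (Fin N) → ℝ) (hdiff : Differentiable ℝ f)
    (x lam s : ℕ → EuclideanSpace ℝ (Fin N))
    (hlam0 : lam 0 = 0)
    (hx : ∀ k : ℕ, x (k + 1) = x k - α • (gradient f (x k)
      + ρ • Matrix.toEuclideanLin Lh (lam k) + ρ • Matrix.toEuclideanLin L (x k)))
    (hlam : ∀ k : ℕ, lam (k + 1) = lam k
      + α • (ρ • Matrix.toEuclideanLin Lh (x (k + 1)))
      - α • Matrix.toEuclideanLin W (ρ • Matrix.toEuclideanLin Lh (x k)))
    (hs : ∀ k : ℕ, s k = gradient f (x k) + ρ • Matrix.toEuclideanLin Lh (lam k)) :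
    s 0 = gradient f (x 0) ∧
    (∀ k : ℕ, x (k + 1) = Matrix.toEuclideanLin W (x k) - α • s k) ∧
    (∀ k : ℕ, s (k + 1) = Matrix.toEuclideanLin W (s k)
      + gradient f (x (k + 1)) - gradient f (x k)) := by
  have hαρ : α * ρ = 1 := by rw [hα]; field_simp
  have hWv : ∀ v, Matrix.toEuclideanLin W v = v - Matrix.toEuclideanLin L v := fun v => by
    simp [hW, Matrix.toEuclideanLin_eq_toLin_orthonormal]
  have hsqv : ∀ v, Matrix.toEuclideanLin Lh (Matrix.toEuclideanLin Lh v)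
      = Matrix.toEuclideanLin L v := fun v => by
    simp [← hsq, Matrix.toLpLin_apply]
  have hcomm : ∀ v, Matrix.toEuclideanLin Lh (Matrix.toEuclideanLin L v)
      = Matrix.toEuclideanLin L (Matrix.toEuclideanLin Lh v) := fun v => by
    rw [← hsqv v, hsqv]
  have hstep : ∀ k, x (k + 1) = Matrix.toEuclideanLin W (x k) - α • s k := fun k => by
    rw [hx, hs, hWv, smul_add α (_ + _), smul_smul α ρ, hαρ, one_smul]
    abel
  refine ⟨by simp [hs, hlam0], hstep, fun k => ?_⟩
  have hdual : Matrix.toEuclideanLin Lh (lam (k + 1))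
      = Matrix.toEuclideanLin Lh (lam k) - α • Matrix.toEuclideanLin L (s k) := by
    rw [hlam, map_smul (Matrix.toEuclideanLin W), smul_smul, smul_smul, hαρ, one_smul, one_smul,
      hWv, map_sub, map_add, map_sub, hsqv, hsqv, hcomm, hsqv, hstep, hWv, map_sub, map_sub,
      map_smul]
    abel
  rw [hs (k + 1), hdual, smul_sub, smul_smul, mul_comm ρ α, hαρ, one_smul, hWv]
  nth_rewrite 2 [hs k]
  abel
end

section
/- Let f : ℝ^n → ℝ be differentiable and μ-strongly convex with μ > 0, let A ∈ ℝ^{m×n}, and define the dual function D(λ) = inf_{x ∈ ℝ^n} { f(x) + λᵀ A x }, which is finite for every λ ∈ ℝ^m. Fix λ ∈ ℝ^m and ρ > 0. Then the augmented Lagrangian 𝓛(x, λ) = f(x) + λᵀ A x + (ρ/2)‖A x‖² has a unique minimizer x⁺ over ℝ^n, and λ⁺ := λ + ρ A x⁺ is the unique maximizer over ℝ^m of the function λ' ↦ D(λ') − ‖λ' − λ‖²/(2ρ); that is, one step of the augmented Lagrangian method on the primal problem equals one step of the proximal point method applied to the dual problem. -/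
open scoped RealInnerProductSpace

/-- The gradient inequality for a convex function. -/
theorem ConvexOn.add_fderiv_le {E : Type*} [NormedAddCommGroup E] [NormedSpace ℝ E]
    {g : E → ℝ} {g' : E →L[ℝ] ℝ} {x : E} (hg : ConvexOn ℝ Set.univ g)
    (hd : HasFDerivAt g g' x) (y : E) : g x + g' (y - x) ≤ g y := by
  have hline : ConvexOn ℝ Set.univ (g ∘ AffineMap.lineMap (k := ℝ) x y) := by
    simpa using hg.comp_affineMap (AffineMap.lineMap (k := ℝ) x y)
  have hderiv : HasDerivAt (g ∘ AffineMap.lineMap (k := ℝ) x y) (g' (y - x)) 0 := by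
    refine HasFDerivAt.comp_hasDerivAt (0 : ℝ) ?_ AffineMap.hasDerivAt_lineMap
    simpa using hd
  have h := hline.le_slope_of_hasDerivAt (Set.mem_univ 0) (Set.mem_univ 1) one_pos hderiv
  simp only [slope, Function.comp_apply, AffineMap.lineMap_apply_zero, AffineMap.lineMap_apply_one,
    sub_zero, inv_one, one_smul, vsub_eq_sub] at h
  linarith

/-- If a convex function is minimized at `a` up to a quadratic error, it is minimized at `a`. -/
theorem ConvexOn.le_of_le_add_sq {E F : Type*} [AddCommGroup E] [Module ℝ E]
    [SeminormedAddCommGroup F] [NormedSpace ℝ F] {h : E → ℝ} (hh : ConvexOn ℝ Set.univ h)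
    (T : E →ₗ[ℝ] F) {c : ℝ} (hc : 0 ≤ c) {a : E}
    (ha : ∀ x, h a ≤ h x + c * ‖T (x - a)‖ ^ 2) (x : E) : h a ≤ h x := by
  by_contra! hlt
  set K := c * ‖T (x - a)‖ ^ 2 with hK
  have hK0 : 0 ≤ K := by positivity
  set δ := h a - h x with hδ
  have hδ0 : 0 < δ := sub_pos.2 hlt
  set t := δ / (δ + K) with ht
  have ht0 : 0 < t := by positivity
  have ht1 : t ≤ 1 := (div_le_one (by positivity)).2 (by linarith)
  have htK : t * (δ + K) = δ := div_mul_cancel₀ _ (by positivity)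
  have hconv := hh.2 (Set.mem_univ a) (Set.mem_univ x) (sub_nonneg.2 ht1) ht0.le (by ring)
  have hmin := ha ((1 - t) • a + t • x)
  have hdir : (1 - t) • a + t • x - a = t • (x - a) := by module
  rw [hdir, map_smul, norm_smul, mul_pow, Real.norm_eq_abs, sq_abs] at hmin
  simp only [smul_eq_mul] at hconv
  have hle : t * δ ≤ t * (t * K) := by
    rw [hδ, hK]; linarith
  have : δ ≤ t * K := le_of_mul_le_mul_left hle ht0
  nlinarith [mul_pos ht0 hδ0]

/-- A differentiable strongly convex function plus a linear functional and a nonnegative continuous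
function attains its minimum. -/
theorem exists_forall_le_of_stronglyConvex {E : Type*} [NormedAddCommGroup E]
    [InnerProductSpace ℝ E] [FiniteDimensional ℝ E] {f : E → ℝ} {μ : ℝ} (hμ : 0 < μ)
    (hf : Differentiable ℝ f)
    (hsc : ConvexOn ℝ Set.univ (fun x : E => f x - μ / 2 * ‖x‖ ^ 2))
    (l : E →L[ℝ] ℝ) {q : E → ℝ} (hq : Continuous q) (hq0 : ∀ x, 0 ≤ q x) :
    ∃ a, ∀ x, f a + l a + q a ≤ f x + l x + q x := by
  have hcont : Continuous fun x => f x + l x + q x := by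
    have := hf.continuous
    fun_prop
  have hd : DifferentiableAt ℝ (fun x : E => f x - μ / 2 * ‖x‖ ^ 2) 0 :=
    (hf 0).sub ((differentiableAt_id.norm_sq ℝ).const_mul _)
  set g' := fderiv ℝ (fun x : E => f x - μ / 2 * ‖x‖ ^ 2) 0
  have hlow : ∀ x, f 0 + ‖x‖ * (μ / 2 * ‖x‖ - ‖g' + l‖) ≤ f x + l x + q x := by
    intro x
    have h1 := hsc.add_fderiv_le hd.hasFDerivAt x
    have h2 := (abs_le.1 ((g' + l).le_opNorm x)).1
    simp only [norm_zero, sub_zero, ne_eq, OfNat.ofNat_ne_zero, not_false_eq_true, zero_pow,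
      mul_zero] at h1
    rw [add_apply] at h2
    have h3 := hq0 x
    change f 0 + g' x ≤ _ at h1
    nlinarith
  have htend : Filter.Tendsto (fun x : E => f 0 + ‖x‖ * (μ / 2 * ‖x‖ - ‖g' + l‖))
      (Filter.cocompact E) Filter.atTop := by
    have hn := tendsto_norm_cocompact_atTop (E := E)
    refine Filter.tendsto_atTop_add_const_left _ _ (hn.atTop_mul_atTop₀ ?_)
    exact Filter.tendsto_atTop_add_const_right _ _ (hn.const_mul_atTop (by positivity))
  exact hcont.exists_forall_le (Filter.tendsto_atTop_mono hlow htend)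

/-- One step of the augmented Lagrangian method on a strongly convex primal problem equals
one step of the proximal point method applied to the dual function
`D(λ) = inf_x { f(x) + λᵀ A x }`. -/
theorem alm_step_is_prox_point_on_dual
    (n m : ℕ) (f : EuclideanSpace ℝ (Fin n) → ℝ)
    (A : Matrix (Fin m) (Fin n) ℝ)
    (μ : ℝ) (hμ : 0 < μ)
    (hdiff : Differentiable ℝ f)
    (hsc : ConvexOn ℝ Set.univ (fun x : EuclideanSpace ℝ (Fin n) => f x - μ / 2 * ‖x‖ ^ 2))
    (hfin : ∀ lam' : EuclideanSpace ℝ (Fin m),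
      BddBelow (Set.range fun x : EuclideanSpace ℝ (Fin n) =>
        f x + ⟪lam', Matrix.toEuclideanLin A x⟫))
    (lam : EuclideanSpace ℝ (Fin m)) (ρ : ℝ) (hρ : 0 < ρ) :
    ∃ xp : EuclideanSpace ℝ (Fin n),
      (∀ x : EuclideanSpace ℝ (Fin n),
        f xp + ⟪lam, Matrix.toEuclideanLin A xp⟫ + ρ / 2 * ‖Matrix.toEuclideanLin A xp‖ ^ 2
          ≤ f x + ⟪lam, Matrix.toEuclideanLin A x⟫ + ρ / 2 * ‖Matrix.toEuclideanLin A x‖ ^ 2) ∧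
      (∀ y : EuclideanSpace ℝ (Fin n),
        (∀ x : EuclideanSpace ℝ (Fin n),
          f y + ⟪lam, Matrix.toEuclideanLin A y⟫ + ρ / 2 * ‖Matrix.toEuclideanLin A y‖ ^ 2
            ≤ f x + ⟪lam, Matrix.toEuclideanLin A x⟫ + ρ / 2 * ‖Matrix.toEuclideanLin A x‖ ^ 2)
          → y = xp) ∧
      (∀ lam' : EuclideanSpace ℝ (Fin m),
        (⨅ x : EuclideanSpace ℝ (Fin n), f x + ⟪lam', Matrix.toEuclideanLin A x⟫)
            - ‖lam' - lam‖ ^ 2 / (2 * ρ)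
          ≤ (⨅ x : EuclideanSpace ℝ (Fin n),
              f x + ⟪lam + ρ • Matrix.toEuclideanLin A xp, Matrix.toEuclideanLin A x⟫)
            - ‖(lam + ρ • Matrix.toEuclideanLin A xp) - lam‖ ^ 2 / (2 * ρ)) ∧
      (∀ ν : EuclideanSpace ℝ (Fin m),
        (∀ lam' : EuclideanSpace ℝ (Fin m),
          (⨅ x : EuclideanSpace ℝ (Fin n), f x + ⟪lam', Matrix.toEuclideanLin A x⟫)
              - ‖lam' - lam‖ ^ 2 / (2 * ρ)
            ≤ (⨅ x : EuclideanSpace ℝ (Fin n), f x + ⟪ν, Matrix.toEuclideanLin A x⟫)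
              - ‖ν - lam‖ ^ 2 / (2 * ρ))
          → ν = lam + ρ • Matrix.toEuclideanLin A xp) := by
  set T := Matrix.toEuclideanLin A with hT
  have hTc : Continuous T := T.continuous_of_finiteDimensional
  have hstrict : StrictConvexOn ℝ Set.univ f :=
    (strongConvexOn_iff_convex.2 hsc).strictConvexOn hμ
  have hlin (ν : EuclideanSpace ℝ (Fin m)) : ConvexOn ℝ Set.univ fun x => ⟪ν, T x⟫ :=
    ((innerₛₗ ℝ ν).comp T).convexOn convex_univ
  have hquad : ConvexOn ℝ Set.univ fun x => ρ / 2 * ‖T x‖ ^ 2 := by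
    have hsq : ConvexOn ℝ Set.univ fun y : EuclideanSpace ℝ (Fin m) => ‖y‖ ^ 2 :=
      convexOn_univ_norm.pow (fun _ _ => norm_nonneg _) 2
    exact (hsq.comp_linearMap T).smul (half_pos hρ).le
  obtain ⟨xp, hxp⟩ := exists_forall_le_of_stronglyConvex hμ hdiff hsc
    ((innerSL ℝ lam).comp (LinearMap.toContinuousLinearMap T))
    (q := fun x => ρ / 2 * ‖T x‖ ^ 2) (by fun_prop) (fun x => by positivity)
  replace hxp : ∀ x, f xp + ⟪lam, T xp⟫ + ρ / 2 * ‖T xp‖ ^ 2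
      ≤ f x + ⟪lam, T x⟫ + ρ / 2 * ‖T x‖ ^ 2 := hxp
  have hdual : (⨅ x, f x + ⟪lam + ρ • T xp, T x⟫) = f xp + ⟪lam + ρ • T xp, T xp⟫ := by
    refine le_antisymm (ciInf_le (hfin _) xp) (le_ciInf ?_)
    refine (hstrict.convexOn.add (hlin _)).le_of_le_add_sq T (half_pos hρ).le fun x => ?_
    have := hxp x
    simp only [Pi.add_apply, map_sub, norm_sub_sq_real, inner_add_left, real_inner_smul_left,
      real_inner_self_eq_norm_sq, real_inner_comm (T xp) (T x)]
    linarith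
  have hgap (ν : EuclideanSpace ℝ (Fin m)) :
      (⨅ x, f x + ⟪ν, T x⟫) - ‖ν - lam‖ ^ 2 / (2 * ρ)
          + ‖ν - (lam + ρ • T xp)‖ ^ 2 / (2 * ρ)
        ≤ (⨅ x, f x + ⟪lam + ρ • T xp, T x⟫)
          - ‖(lam + ρ • T xp) - lam‖ ^ 2 / (2 * ρ) := by
    have hle := ciInf_le (hfin ν) xp
    have hexp : ‖ν - (lam + ρ • T xp)‖ ^ 2 / (2 * ρ) = ‖ν - lam‖ ^ 2 / (2 * ρ)
        - ⟪ν - lam, T xp⟫ + ρ / 2 * ‖T xp‖ ^ 2 := by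
      rw [← sub_sub, norm_sub_sq_real, real_inner_smul_right, norm_smul, mul_pow,
        Real.norm_eq_abs, sq_abs]
      field_simp
    have hstep : ‖(lam + ρ • T xp) - lam‖ ^ 2 / (2 * ρ) = ρ / 2 * ‖T xp‖ ^ 2 := by
      rw [add_sub_cancel_left, norm_smul, mul_pow, Real.norm_eq_abs, sq_abs]
      field_simp
    rw [hdual, hexp, hstep, inner_add_left, real_inner_smul_left, real_inner_self_eq_norm_sq,
      inner_sub_left]
    linarith
  refine ⟨xp, hxp, fun y hy => ?_, fun ν => ?_, fun ν hν => ?_⟩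
  · exact ((hstrict.add_convexOn (hlin lam)).add_convexOn hquad).eq_of_isMinOn
      (fun x _ => hy x) (fun x _ => hxp x) (Set.mem_univ y) (Set.mem_univ xp)
  · have : 0 ≤ ‖ν - (lam + ρ • T xp)‖ ^ 2 / (2 * ρ) := by positivity
    linarith [hgap ν]
  · have h0 : ‖ν - (lam + ρ • T xp)‖ ^ 2 / (2 * ρ) ≤ 0 := by
      linarith [hgap ν, hν (lam + ρ • T xp)]
    rw [div_le_iff₀ (by positivity), zero_mul] at h0
    exact sub_eq_zero.1 (norm_eq_zero.1 (pow_eq_zero_iff two_ne_zero |>.1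
      (le_antisymm h0 (sq_nonneg _))))
end

section
/- Let f : ℝ^n → ℝ be continuous and μ-strongly convex with μ > 0, and let A ∈ ℝ^{m×n}. For each λ ∈ ℝ^m let x(λ) denote the unique minimizer over ℝ^n of x ↦ f(x) + λᵀ A x. Then the map λ ↦ x(λ) is Lipschitz continuous: for all λ, λ' ∈ ℝ^m, ‖x(λ) − x(λ')‖ ≤ (‖A‖/μ) ‖λ − λ'‖, where ‖A‖ is the operator (spectral) norm of A. -/
open scoped RealInnerProductSpace

/-- Quadratic growth of a strongly convex function away from a minimizer. -/
theorem StrongConvexOn.add_sq_norm_le_of_isMinOn {E : Type*} [NormedAddCommGroup E]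
    [NormedSpace ℝ E] {s : Set E} {m : ℝ} {g : E → ℝ} (hg : StrongConvexOn s m g) {x y : E}
    (hx : x ∈ s) (hy : y ∈ s) (hmin : IsMinOn g s x) :
    g x + m / 2 * ‖x - y‖ ^ 2 ≤ g y := by
  have key : ∀ t ∈ Set.Ioo (0 : ℝ) 1, g x + (1 - t) * (m / 2 * ‖x - y‖ ^ 2) ≤ g y := by
    rintro t ⟨ht0, ht1⟩
    have hle := hg.2 hx hy (sub_nonneg.2 ht1.le) ht0.le (sub_add_cancel 1 t)
    have hge := isMinOn_iff.1 hmin _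
      (hg.1 hx hy (sub_nonneg.2 ht1.le) ht0.le (sub_add_cancel 1 t))
    simp only [smul_eq_mul] at hle
    refine le_of_mul_le_mul_left ?_ ht0
    linarith
  have hlim : Filter.Tendsto (fun t : ℝ => g x + (1 - t) * (m / 2 * ‖x - y‖ ^ 2))
      (nhdsWithin 0 (Set.Ioi 0)) (nhds (g x + (1 - 0) * (m / 2 * ‖x - y‖ ^ 2))) :=
    Continuous.tendsto (by fun_prop) 0 |>.mono_left nhdsWithin_le_nhds
  have hbound := le_of_tendsto hlim
    (Filter.eventually_of_mem (Ioo_mem_nhdsGT one_pos) key)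
  simpa using hbound

/-- Minimizers of two linear perturbations of a strongly convex function differ by at most a
multiple of the difference of the multipliers. -/
theorem StrongConvexOn.norm_sub_le_of_isMinOn_add_inner {E F : Type*} [NormedAddCommGroup E]
    [NormedSpace ℝ E] [NormedAddCommGroup F] [InnerProductSpace ℝ F] {s : Set E}
    {μ : ℝ} (hμ : 0 < μ) {f : E → ℝ} (hf : StrongConvexOn s μ f) (T : E →L[ℝ] F) {a b : F}
    {x y : E} (hx : x ∈ s) (hy : y ∈ s) (hxmin : IsMinOn (fun z => f z + ⟪a, T z⟫) s x)
    (hymin : IsMinOn (fun z => f z + ⟪b, T z⟫) s y) :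
    ‖x - y‖ ≤ ‖T‖ / μ * ‖a - b‖ := by
  have hperturb (c : F) : StrongConvexOn s μ (fun z => f z + ⟪c, T z⟫) := by
    have hlin : ConvexOn ℝ s (fun z => ⟪c, T z⟫) :=
      ((innerSL ℝ c).comp T).toLinearMap.convexOn hf.1
    have hsum := UniformConvexOn.add hf (uniformConvexOn_zero.2 hlin)
    rwa [add_zero] at hsum
  have hgrowx := (hperturb a).add_sq_norm_le_of_isMinOn hx hy hxmin
  have hgrowy := (hperturb b).add_sq_norm_le_of_isMinOn hy hx hymin
  rw [norm_sub_rev y x] at hgrowy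
  have hinner : ⟪a - b, T (y - x)⟫ = ⟪a, T y⟫ - ⟪a, T x⟫ + ⟪b, T x⟫ - ⟪b, T y⟫ := by
    rw [map_sub, inner_sub_left, inner_sub_right, inner_sub_right]
    ring
  have hcs : ⟪a - b, T (y - x)⟫ ≤ ‖a - b‖ * (‖T‖ * ‖x - y‖) := by
    refine (real_inner_le_norm _ _).trans ?_
    rw [norm_sub_rev x y]
    gcongr
    exact T.le_opNorm _
  rw [div_mul_eq_mul_div, le_div_iff₀ hμ]
  rcases (norm_nonneg (x - y)).eq_or_lt with hzero | hpos
  · rw [← hzero, zero_mul]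
    positivity
  · refine le_of_mul_le_mul_right ?_ hpos
    linarith

/-- Lipschitz continuity of the Lagrangian minimizer map `λ ↦ x(λ)` for a continuous
`μ`-strongly convex `f`: `‖x(λ) - x(λ')‖ ≤ (‖A‖/μ) ‖λ - λ'‖`. -/
theorem lagrangian_minimizer_lipschitz
    (n m : ℕ) (f : EuclideanSpace ℝ (Fin n) → ℝ)
    (A : Matrix (Fin m) (Fin n) ℝ)
    (μ : ℝ) (hμ : 0 < μ)
    (hcont : Continuous f)
    (hsc : ConvexOn ℝ Set.univ (fun x : EuclideanSpace ℝ (Fin n) => f x - μ / 2 * ‖x‖ ^ 2))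
    (xmin : EuclideanSpace ℝ (Fin m) → EuclideanSpace ℝ (Fin n))
    (hxmin : ∀ lam : EuclideanSpace ℝ (Fin m), ∀ x : EuclideanSpace ℝ (Fin n),
      f (xmin lam) + ⟪lam, Matrix.toEuclideanLin A (xmin lam)⟫
        ≤ f x + ⟪lam, Matrix.toEuclideanLin A x⟫) :
    ∀ lam lam' : EuclideanSpace ℝ (Fin m),
      ‖xmin lam - xmin lam'‖
        ≤ ‖LinearMap.toContinuousLinearMap (Matrix.toEuclideanLin A)‖ / μ * ‖lam - lam'‖ := by
  intro lam lam'
  have hmin (c : EuclideanSpace ℝ (Fin m)) : IsMinOn (fun z => f z +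
      ⟪c, LinearMap.toContinuousLinearMap (Matrix.toEuclideanLin A) z⟫) Set.univ (xmin c) :=
    isMinOn_iff.2 fun z _ => hxmin c z
  exact (strongConvexOn_iff_convex.2 hsc).norm_sub_le_of_isMinOn_add_inner hμ _
    (Set.mem_univ _) (Set.mem_univ _) (hmin lam) (hmin lam')
end

section
/- Let φ : ℝ^n → ℝ be convex and continuous, let α > 0, and suppose φ attains its minimum at some x⋆ ∈ ℝ^n. Define the proximal point iterates by x^{(k+1)} = argmin_{x ∈ ℝ^n} { φ(x) + (1/(2α))‖x − x^{(k)}‖² } (each such minimizer exists and is unique), starting from any x^{(0)} ∈ ℝ^n. Then for every k ≥ 1, φ(x^{(k)}) − φ(x⋆) ≤ ‖x^{(0)} − x⋆‖² / (2 α k); that is, the proximal point method converges at rate 1/k for convex functions. -/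
section ProximalPoint

variable {E : Type*} [NormedAddCommGroup E] [InnerProductSpace ℝ E]

lemma norm_lineMap_sub_sq (p y z : E) (t : ℝ) :
    ‖(1 - t) • p + t • y - z‖ ^ 2 =
      (1 - t) * ‖p - z‖ ^ 2 + t * ‖y - z‖ ^ 2 - t * (1 - t) * ‖y - p‖ ^ 2 := by
  have h₁ : (1 - t) • p + t • y - z = (1 - t) • (p - z) + t • (y - z) := by module
  have h₂ : y - p = (y - z) - (p - z) := by abel
  rw [h₁, h₂, norm_add_sq_real, norm_sub_sq_real (y - z), norm_smul, norm_smul, mul_pow, mul_pow,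
    Real.norm_eq_abs, Real.norm_eq_abs, sq_abs, sq_abs, real_inner_smul_left,
    real_inner_smul_right, real_inner_comm (p - z) (y - z)]
  ring

/-- The three-point inequality for a proximal step. -/
lemma ConvexOn.prox_three_point {φ : E → ℝ} (hφ : ConvexOn ℝ Set.univ φ) {c : ℝ} {p z : E}
    (hp : ∀ y, φ p + c * ‖p - z‖ ^ 2 ≤ φ y + c * ‖y - z‖ ^ 2) (y : E) :
    φ p + c * ‖p - z‖ ^ 2 + c * ‖y - p‖ ^ 2 ≤ φ y + c * ‖y - z‖ ^ 2 := by
  have key : ∀ t ∈ Set.Ioo (0 : ℝ) 1,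
      φ p + c * ‖p - z‖ ^ 2 + c * (1 - t) * ‖y - p‖ ^ 2 ≤ φ y + c * ‖y - z‖ ^ 2 := by
    rintro t ⟨ht₀, ht₁⟩
    have h₁ := hp ((1 - t) • p + t • y)
    have h₂ := hφ.2 (Set.mem_univ p) (Set.mem_univ y) (sub_nonneg.2 ht₁.le) ht₀.le
      (sub_add_cancel 1 t)
    rw [norm_lineMap_sub_sq] at h₁
    simp only [smul_eq_mul] at h₂
    refine le_of_mul_le_mul_left ?_ ht₀
    linarith
  have hlim : Filter.Tendsto
      (fun t : ℝ => φ p + c * ‖p - z‖ ^ 2 + c * (1 - t) * ‖y - p‖ ^ 2)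
      (nhdsWithin 0 (Set.Ioi 0)) (nhds (φ p + c * ‖p - z‖ ^ 2 + c * ‖y - p‖ ^ 2)) := by
    refine tendsto_nhdsWithin_of_tendsto_nhds (Continuous.tendsto' (by fun_prop) _ _ ?_)
    simp
  refine le_of_tendsto hlim ?_
  filter_upwards [Ioo_mem_nhdsGT (zero_lt_one (α := ℝ))] with t ht using key t ht

/-- The Lyapunov function `k (φ (x k) - φ s) + c ‖s - x k‖ ^ 2` of the proximal point method
never exceeds its initial value. -/
lemma ConvexOn.prox_point_lyapunov {φ : E → ℝ} (hφ : ConvexOn ℝ Set.univ φ) {c : ℝ}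
    (hc : 0 ≤ c) {x : ℕ → E}
    (hx : ∀ k y, φ (x (k + 1)) + c * ‖x (k + 1) - x k‖ ^ 2 ≤ φ y + c * ‖y - x k‖ ^ 2)
    (s : E) (k : ℕ) :
    k * (φ (x k) - φ s) + c * ‖s - x k‖ ^ 2 ≤ c * ‖s - x 0‖ ^ 2 := by
  induction k with
  | zero => simp
  | succ k ih =>
    have h₁ := hφ.prox_three_point (hx k) s
    have hstep : 0 ≤ c * ‖x (k + 1) - x k‖ ^ 2 := by positivity
    have hmono : φ (x (k + 1)) ≤ φ (x k) := by
      have h := hx k (x k)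
      simp only [sub_self, norm_zero] at h
      linarith
    have h₂ := mul_le_mul_of_nonneg_left hmono (Nat.cast_nonneg (α := ℝ) k)
    push_cast
    linarith

end ProximalPoint


/-- `1/k` convergence rate of the proximal point method for a convex continuous function
attaining its minimum. -/
theorem prox_point_rate
    (n : ℕ) (φ : EuclideanSpace ℝ (Fin n) → ℝ)
    (hconv : ConvexOn ℝ Set.univ φ)
    (hcont : Continuous φ)
    (α : ℝ) (hα : 0 < α)
    (xs : EuclideanSpace ℝ (Fin n))
    (hxs : ∀ y : EuclideanSpace ℝ (Fin n), φ xs ≤ φ y)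
    (x : ℕ → EuclideanSpace ℝ (Fin n))
    (hx : ∀ k : ℕ, ∀ y : EuclideanSpace ℝ (Fin n),
      φ (x (k + 1)) + 1 / (2 * α) * ‖x (k + 1) - x k‖ ^ 2
        ≤ φ y + 1 / (2 * α) * ‖y - x k‖ ^ 2) :
    ∀ k : ℕ, 1 ≤ k → φ (x k) - φ xs ≤ ‖x 0 - xs‖ ^ 2 / (2 * α * k) := by
  intro k hk
  have hk' : (0 : ℝ) < k := by exact_mod_cast hk
  have h := hconv.prox_point_lyapunov (by positivity) hx xs k
  have hdist : 0 ≤ 1 / (2 * α) * ‖xs - x k‖ ^ 2 := by positivity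
  have hrate : (k : ℝ) * (φ (x k) - φ xs) ≤ 1 / (2 * α) * ‖x 0 - xs‖ ^ 2 := by
    rw [norm_sub_rev (x 0)]
    linarith
  calc φ (x k) - φ xs ≤ 1 / (2 * α) * ‖x 0 - xs‖ ^ 2 / k := by
        rwa [le_div_iff₀' hk']
    _ = ‖x 0 - xs‖ ^ 2 / (2 * α * k) := by
        field_simp
end

section
/- Let f : ℝ^n → ℝ be differentiable and μ-strongly convex with μ > 0, let A ∈ ℝ^{m×n}, ρ > 0, and let D(λ) = inf_{x ∈ ℝ^n} { f(x) + λᵀ A x } be the dual function, which is differentiable with ∇D(λ) = A x(λ), where x(λ) is the unique minimizer of x ↦ f(x) + λᵀ A x. If x⁺ is the unique minimizer of the augmented Lagrangian 𝓛(x, λ) = f(x) + λᵀ A x + (ρ/2)‖A x‖² and λ⁺ = λ + ρ A x⁺, then A x⁺ = ∇D(λ⁺); that is, the augmented Lagrangian dual update is the implicit (backward) gradient ascent step λ⁺ = λ + ρ ∇D(λ⁺) on the dual function. -/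
open scoped RealInnerProductSpace

/-- A minimizer of the augmented Lagrangian of a convex function is a minimizer of the ordinary
Lagrangian at the updated multiplier. -/
theorem ConvexOn.lagrangian_le_of_augmentedLagrangian_le
    {E F : Type*} [AddCommGroup E] [Module ℝ E] [NormedAddCommGroup F] [InnerProductSpace ℝ F]
    {f : E → ℝ} (hf : ConvexOn ℝ Set.univ f) (L : E →ₗ[ℝ] F) (ρ : ℝ) (lam : F) (xp : E)
    (hxp : ∀ x, f xp + ⟪lam, L xp⟫ + ρ / 2 * ‖L xp‖ ^ 2
      ≤ f x + ⟪lam, L x⟫ + ρ / 2 * ‖L x‖ ^ 2) (x : E) :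
    f xp + ⟪lam + ρ • L xp, L xp⟫ ≤ f x + ⟪lam + ρ • L xp, L x⟫ := by
  set d : F := L x - L xp with hd
  set G : ℝ := f x - f xp + ⟪lam, d⟫ + ρ * ⟪L xp, d⟫ with hG
  set K : ℝ := ρ / 2 * ‖d‖ ^ 2 with hK
  have key : ∀ t ∈ Set.Ioc (0 : ℝ) 1, 0 ≤ G + t * K := by
    rintro t ⟨ht0, ht1⟩
    have hconv := hf.2 (Set.mem_univ xp) (Set.mem_univ x) (sub_nonneg.2 ht1) ht0.le (by ring)
    have hmin := hxp ((1 - t) • xp + t • x)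
    have hL : L ((1 - t) • xp + t • x) = L xp + t • d := by
      rw [map_add, map_smul, map_smul, hd]
      module
    rw [hL, norm_add_sq_real, inner_add_right, inner_smul_right, inner_smul_right, norm_smul,
      mul_pow, Real.norm_eq_abs, sq_abs] at hmin
    simp only [smul_eq_mul] at hconv
    refine nonneg_of_mul_nonneg_right (a := t) ?_ ht0
    rw [hG, hK]
    linarith
  have hlim : Filter.Tendsto (fun t : ℝ => G + t * K) (nhdsWithin 0 (Set.Ioi 0)) (nhds G) := by
    have hcont : Continuous fun t : ℝ => G + t * K := by fun_prop
    simpa using (hcont.tendsto 0).mono_left nhdsWithin_le_nhds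
  have hG0 : 0 ≤ G := ge_of_tendsto hlim
    (Filter.eventually_of_mem (Ioc_mem_nhdsGT zero_lt_one) key)
  have hdiff : ⟪lam + ρ • L xp, L x⟫ - ⟪lam + ρ • L xp, L xp⟫
      = ⟪lam, d⟫ + ρ * ⟪L xp, d⟫ := by
    rw [← inner_sub_right, inner_add_left, real_inner_smul_left]
  linarith

/-- The augmented Lagrangian dual update is an implicit (backward) gradient ascent step
on the dual function: if `x⁺` is the unique minimizer of `𝓛(·, λ)` and
`λ⁺ = λ + ρ A x⁺`, then `A x⁺ = ∇D(λ⁺)`, i.e. `λ⁺ = λ + ρ ∇D(λ⁺)`. -/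
theorem alm_dual_update_is_implicit_ascent
    (n m : ℕ) (f : EuclideanSpace ℝ (Fin n) → ℝ)
    (A : Matrix (Fin m) (Fin n) ℝ)
    (μ : ℝ) (hμ : 0 < μ)
    (hdiff : Differentiable ℝ f)
    (hsc : ConvexOn ℝ Set.univ (fun x : EuclideanSpace ℝ (Fin n) => f x - μ / 2 * ‖x‖ ^ 2))
    (xmin : EuclideanSpace ℝ (Fin m) → EuclideanSpace ℝ (Fin n))
    (hxmin : ∀ lam' : EuclideanSpace ℝ (Fin m), ∀ x : EuclideanSpace ℝ (Fin n),
      f (xmin lam') + ⟪lam', Matrix.toEuclideanLin A (xmin lam')⟫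
        ≤ f x + ⟪lam', Matrix.toEuclideanLin A x⟫)
    (hxmin_uniq : ∀ lam' : EuclideanSpace ℝ (Fin m), ∀ y : EuclideanSpace ℝ (Fin n),
      (∀ x : EuclideanSpace ℝ (Fin n),
        f y + ⟪lam', Matrix.toEuclideanLin A y⟫ ≤ f x + ⟪lam', Matrix.toEuclideanLin A x⟫)
        → y = xmin lam')
    (hD : ∀ lam' : EuclideanSpace ℝ (Fin m),
      HasGradientAt (fun ν : EuclideanSpace ℝ (Fin m) =>
          ⨅ x : EuclideanSpace ℝ (Fin n), f x + ⟪ν, Matrix.toEuclideanLin A x⟫)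
        (Matrix.toEuclideanLin A (xmin lam')) lam')
    (ρ : ℝ) (hρ : 0 < ρ)
    (lam : EuclideanSpace ℝ (Fin m))
    (xp : EuclideanSpace ℝ (Fin n))
    (hxp : ∀ x : EuclideanSpace ℝ (Fin n),
      f xp + ⟪lam, Matrix.toEuclideanLin A xp⟫ + ρ / 2 * ‖Matrix.toEuclideanLin A xp‖ ^ 2
        ≤ f x + ⟪lam, Matrix.toEuclideanLin A x⟫ + ρ / 2 * ‖Matrix.toEuclideanLin A x‖ ^ 2) :
    Matrix.toEuclideanLin A xp
      = gradient (fun ν : EuclideanSpace ℝ (Fin m) =>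
          ⨅ x : EuclideanSpace ℝ (Fin n), f x + ⟪ν, Matrix.toEuclideanLin A x⟫)
        (lam + ρ • Matrix.toEuclideanLin A xp) := by
  have hf : ConvexOn ℝ Set.univ f :=
    ((strongConvexOn_iff_convex.2 hsc).strictConvexOn hμ).convexOn
  rw [(hD _).gradient, ← hxmin_uniq _ xp
    (hf.lagrangian_le_of_augmentedLagrangian_le (Matrix.toEuclideanLin A) ρ lam xp hxp)]
end
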